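/- For every l ∈ ℕ, the third mixed derivative of P_l ∘ h along V once in the x-variables and twice in the y-variables, evaluated on the diagonal, satisfies V_x V_y V_y P_l(h)|_{x=y} = ã₂₄(θ, φ) P_l'(1), where ã₂₄(θ, φ) = v₁² (∂v₁/∂θ) sin²φ + v₁ (∂v₁/∂φ) v₂ sin²φ + v₁² v₂ sinφ cosφ + v₁ v₂ (∂v₂/∂θ) + v₂² (∂v₂/∂φ), with all functions evaluated at (θ, φ). -/

import Mathlib

open Real

/-- The degree-`l` Legendre polynomial, via the Rodrigues formula
`P_l(t) = 1/(2^l l!) dˡ/dtˡ (t² − 1)ˡ`. -/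
noncomputable def legP (l : ℕ) : ℝ → ℝ :=
  fun t => (1 / (2 ^ l * (Nat.factorial l : ℝ))) * iteratedDeriv l (fun s => (s ^ 2 - 1) ^ l) t

/-- `h(θ_x, φ_x, θ_y, φ_y)`, the cosine of the spherical distance. -/
noncomputable def sphH (θx φx θy φy : ℝ) : ℝ :=
  Real.cos φx * Real.cos φy + Real.sin φx * Real.sin φy * Real.cos (θx - θy)

/-- Functions of the four variables `(θ_x, φ_x, θ_y, φ_y)`. -/
abbrev F4 : Type := ℝ → ℝ → ℝ → ℝ → ℝ

/-- `∂/∂θ_x`. -/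
noncomputable def pθx (f : F4) : F4 := fun a b c d => deriv (fun t => f t b c d) a
/-- `∂/∂φ_x`. -/
noncomputable def pφx (f : F4) : F4 := fun a b c d => deriv (fun t => f a t c d) b
/-- `∂/∂θ_y`. -/
noncomputable def pθy (f : F4) : F4 := fun a b c d => deriv (fun t => f a b t d) c
/-- `∂/∂φ_y`. -/
noncomputable def pφy (f : F4) : F4 := fun a b c d => deriv (fun t => f a b c t) d

/-- The operator `V_x = v₁(θ_x,φ_x) ∂/∂θ_x + v₂(θ_x,φ_x) ∂/∂φ_x`. -/
noncomputable def Vx (v₁ v₂ : ℝ → ℝ → ℝ) (f : F4) : F4 :=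
  fun a b c d => v₁ a b * pθx f a b c d + v₂ a b * pφx f a b c d

/-- The operator `V_y = v₁(θ_y,φ_y) ∂/∂θ_y + v₂(θ_y,φ_y) ∂/∂φ_y`. -/
noncomputable def Vy (v₁ v₂ : ℝ → ℝ → ℝ) (f : F4) : F4 :=
  fun a b c d => v₁ c d * pθy f a b c d + v₂ c d * pφy f a b c d

/-- The operator `V_x^⊥ = v₂(θ_x,φ_x) ∂/∂θ_x − sin²(φ_x) v₁(θ_x,φ_x) ∂/∂φ_x`. -/
noncomputable def Vxp (v₁ v₂ : ℝ → ℝ → ℝ) (f : F4) : F4 :=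
  fun a b c d => v₂ a b * pθx f a b c d - (Real.sin b) ^ 2 * v₁ a b * pφx f a b c d

/-- The operator `V_y^⊥ = v₂(θ_y,φ_y) ∂/∂θ_y − sin²(φ_y) v₁(θ_y,φ_y) ∂/∂φ_y`. -/
noncomputable def Vyp (v₁ v₂ : ℝ → ℝ → ℝ) (f : F4) : F4 :=
  fun a b c d => v₂ c d * pθy f a b c d - (Real.sin d) ^ 2 * v₁ c d * pφy f a b c d

/-- `P_l ∘ h` as a function of the four variables. -/
noncomputable def PH (l : ℕ) : F4 := fun a b c d => legP l (sphH a b c d)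

/-- The Legendre polynomial function `legP l` is smooth. -/
theorem contDiff_legP (l : ℕ) : ContDiff ℝ (⊤ : ℕ∞) (legP l) := by
  unfold legP
  refine contDiff_const.mul ?_
  rw [iteratedDeriv_eq_iterate]
  exact ContDiff.iterate_deriv l (by fun_prop)

theorem hasDerivAt_sphH_θx (a b c d : ℝ) :
    HasDerivAt (fun t => sphH t b c d) (-(sin b * sin d * sin (a - c))) a := by
  unfold sphH
  convert! (((hasDerivAt_id a).sub_const c).cos.const_mul (sin b * sin d)).const_add
    (cos b * cos d) using 1
  simp

theorem hasDerivAt_sphH_φx (a b c d : ℝ) :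
    HasDerivAt (fun t => sphH a t c d)
      (-sin b * cos d + cos b * sin d * cos (a - c)) b := by
  unfold sphH
  exact ((hasDerivAt_cos b).mul_const _).add
    (((hasDerivAt_sin b).mul_const _).mul_const _)

theorem hasDerivAt_sphH_θy (a b c d : ℝ) :
    HasDerivAt (fun t => sphH a b t d) (sin b * sin d * sin (a - c)) c := by
  unfold sphH
  convert! (((hasDerivAt_id c).const_sub a).cos.const_mul (sin b * sin d)).const_add
    (cos b * cos d) using 1
  simp

theorem hasDerivAt_sphH_φy (a b c d : ℝ) :
    HasDerivAt (fun t => sphH a b c t)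
      (-cos b * sin d + sin b * cos d * cos (a - c)) d := by
  unfold sphH
  convert! ((hasDerivAt_cos d).const_mul (cos b)).add
    (((hasDerivAt_sin d).const_mul (sin b)).mul_const (cos (a - c))) using 1
  ring

/-- The closed form of `V_y h`. -/
noncomputable def vySphH (v₁ v₂ : ℝ → ℝ → ℝ) : F4 := fun a b c d =>
  v₁ c d * (sin b * sin d * sin (a - c)) +
    v₂ c d * (-cos b * sin d + sin b * cos d * cos (a - c))

theorem Vy_comp_sphH (v₁ v₂ : ℝ → ℝ → ℝ) {P : ℝ → ℝ} (hP : Differentiable ℝ P) :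
    Vy v₁ v₂ (fun a b c d => P (sphH a b c d)) =
      fun a b c d => deriv P (sphH a b c d) * vySphH v₁ v₂ a b c d := by
  funext a b c d
  have h₁ := (hP (sphH a b c d)).hasDerivAt.comp c (hasDerivAt_sphH_θy a b c d)
  have h₂ := (hP (sphH a b c d)).hasDerivAt.comp d (hasDerivAt_sphH_φy a b c d)
  simp only [Function.comp_def] at h₁ h₂
  simp only [Vy, pθy, pφy, vySphH, h₁.deriv, h₂.deriv]
  ring

/-- The closed form of `V_y V_y h`. -/
noncomputable def vyVySphH (v₁ v₂ : ℝ → ℝ → ℝ) : F4 := fun a b c d =>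
  v₁ c d * (deriv (fun t => v₁ t d) c * (sin b * sin d * sin (a - c)) -
      v₁ c d * (sin b * sin d * cos (a - c)) +
      deriv (fun t => v₂ t d) c * (-cos b * sin d + sin b * cos d * cos (a - c)) +
      v₂ c d * (sin b * cos d * sin (a - c))) +
    v₂ c d * (deriv (fun t => v₁ c t) d * (sin b * sin d * sin (a - c)) +
      v₁ c d * (sin b * cos d * sin (a - c)) +
      deriv (fun t => v₂ c t) d * (-cos b * sin d + sin b * cos d * cos (a - c)) +
      v₂ c d * (-cos b * cos d - sin b * sin d * cos (a - c)))

theorem Vy_mul_vySphH {v₁ v₂ : ℝ → ℝ → ℝ} (hv₁ : Differentiable ℝ (Function.uncurry v₁))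
    (hv₂ : Differentiable ℝ (Function.uncurry v₂)) {P : ℝ → ℝ} (hP : Differentiable ℝ P) :
    Vy v₁ v₂ (fun a b c d => P (sphH a b c d) * vySphH v₁ v₂ a b c d) =
      fun a b c d => deriv P (sphH a b c d) * vySphH v₁ v₂ a b c d ^ 2 +
        P (sphH a b c d) * vyVySphH v₁ v₂ a b c d := by
  funext a b c d
  have slice₁ {v : ℝ → ℝ → ℝ} (hv : Differentiable ℝ (Function.uncurry v)) :
      HasDerivAt (fun t => v t d) (deriv (fun t => v t d) c) c :=
    (hv.comp (differentiable_id.prodMk (differentiable_const d)) c).hasDerivAt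
  have slice₂ {v : ℝ → ℝ → ℝ} (hv : Differentiable ℝ (Function.uncurry v)) :
      HasDerivAt (fun t => v c t) (deriv (fun t => v c t) d) d :=
    (hv.comp ((differentiable_const c).prodMk differentiable_id) d).hasDerivAt
  have hs : HasDerivAt (fun t => sin (a - t)) (-cos (a - c)) c := by
    simpa using ((hasDerivAt_id c).const_sub a).sin
  have hc : HasDerivAt (fun t => cos (a - t)) (sin (a - c)) c := by
    simpa using ((hasDerivAt_id c).const_sub a).cos
  have g₁ := ((slice₁ hv₁).mul (hs.const_mul (sin b * sin d))).add
    ((slice₁ hv₂).mul ((hc.const_mul (sin b * cos d)).const_add (-cos b * sin d)))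
  have g₂ := ((slice₂ hv₁).mul
      (((hasDerivAt_sin d).const_mul (sin b)).mul_const (sin (a - c)))).add
    ((slice₂ hv₂).mul (((hasDerivAt_sin d).const_mul (-cos b)).add
      (((hasDerivAt_cos d).const_mul (sin b)).mul_const (cos (a - c)))))
  have h₁ := ((hP (sphH a b c d)).hasDerivAt.comp c (hasDerivAt_sphH_θy a b c d)).mul g₁
  have h₂ := ((hP (sphH a b c d)).hasDerivAt.comp d (hasDerivAt_sphH_φy a b c d)).mul g₂
  have e₁ : pθy (fun a b c d => P (sphH a b c d) * vySphH v₁ v₂ a b c d) a b c d = _ := h₁.deriv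
  have e₂ : pφy (fun a b c d => P (sphH a b c d) * vySphH v₁ v₂ a b c d) a b c d = _ := h₂.deriv
  rw [Vy, e₁, e₂]
  simp only [vySphH, vyVySphH, Function.comp_apply, Pi.mul_apply, Pi.add_apply]
  ring

theorem sphH_self (θ φ : ℝ) : sphH θ φ θ φ = 1 := by
  simp only [sphH, sub_self, cos_zero]
  linear_combination sin_sq_add_cos_sq φ

theorem vySphH_self (v₁ v₂ : ℝ → ℝ → ℝ) (θ φ : ℝ) : vySphH v₁ v₂ θ φ θ φ = 0 := by
  simp only [vySphH, sub_self, cos_zero, sin_zero]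
  ring

/-- If `h` is stationary and `g` vanishes at a point, only the derivative of `k` survives in that
of `Q(h) g² + P(h) k`. -/
theorem hasDerivAt_comp_mul_sq_add {Q P h g k : ℝ → ℝ} {x g' k' : ℝ}
    (hQ : Differentiable ℝ Q) (hP : Differentiable ℝ P) (hh : HasDerivAt h 0 x)
    (hg : HasDerivAt g g' x) (hg0 : g x = 0) (hk : HasDerivAt k k' x) :
    HasDerivAt (fun t => Q (h t) * g t ^ 2 + P (h t) * k t) (P (h x) * k') x := by
  have := (((hQ (h x)).hasDerivAt.comp x hh).mul (hg.pow 2)).add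
    (((hP (h x)).hasDerivAt.comp x hh).mul hk)
  convert! this using 1
  simp [hg0]

/-- `V_x V_y V_y P_l(h)` on the diagonal equals `ã₂₄(θ,φ) P_l'(1)`. -/
theorem VxVyVy_on_diagonal
    (v₁ v₂ : ℝ → ℝ → ℝ)
    (hv₁ : ContDiff ℝ (⊤ : ℕ∞) (Function.uncurry v₁)) (hv₂ : ContDiff ℝ (⊤ : ℕ∞) (Function.uncurry v₂))
    (l : ℕ) (θ φ : ℝ) (hφ : φ ∈ Set.Ioo 0 π) :
    Vx v₁ v₂ (Vy v₁ v₂ (Vy v₁ v₂ (PH l))) θ φ θ φ =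
      ((v₁ θ φ) ^ 2 * deriv (fun t => v₁ t φ) θ * (Real.sin φ) ^ 2 +
        v₁ θ φ * deriv (fun t => v₁ θ t) φ * v₂ θ φ * (Real.sin φ) ^ 2 +
        (v₁ θ φ) ^ 2 * v₂ θ φ * Real.sin φ * Real.cos φ +
        v₁ θ φ * v₂ θ φ * deriv (fun t => v₂ t φ) θ +
        (v₂ θ φ) ^ 2 * deriv (fun t => v₂ θ t) φ) * deriv (legP l) 1 := by
  have hd : ∀ n : ℕ, Differentiable ℝ (deriv^[n] (legP l)) := fun n =>
    (ContDiff.iterate_deriv n (contDiff_legP l)).differentiable (by simp)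
  have hPH : Vy v₁ v₂ (Vy v₁ v₂ (PH l)) = fun a b c d =>
      deriv (deriv (legP l)) (sphH a b c d) * vySphH v₁ v₂ a b c d ^ 2 +
        deriv (legP l) (sphH a b c d) * vyVySphH v₁ v₂ a b c d := by
    unfold PH
    rw [Vy_comp_sphH v₁ v₂ (P := legP l) (hd 0),
      Vy_mul_vySphH (P := deriv (legP l)) (hv₁.differentiable (by simp))
        (hv₂.differentiable (by simp)) (hd 1)]
  have hs : HasDerivAt (fun t => sin (t - θ)) 1 θ := by
    simpa using ((hasDerivAt_id θ).sub_const θ).sin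
  have hc : HasDerivAt (fun t => cos (t - θ)) 0 θ := by
    simpa using ((hasDerivAt_id θ).sub_const θ).cos
  have hhθ : HasDerivAt (fun t => sphH t φ θ φ) 0 θ := by
    simpa using hasDerivAt_sphH_θx θ φ θ φ
  have hhφ : HasDerivAt (fun t => sphH θ t θ φ) 0 φ := by
    convert! hasDerivAt_sphH_φx θ φ θ φ using 1
    simp only [sub_self, cos_zero]
    ring
  have gθ : Differentiable ℝ (fun t => vySphH v₁ v₂ t φ θ φ) := by
    unfold vySphH; fun_prop
  have gφ : Differentiable ℝ (fun t => vySphH v₁ v₂ θ t θ φ) := by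
    unfold vySphH; fun_prop
  have kθ : HasDerivAt (fun t => vyVySphH v₁ v₂ t φ θ φ)
      (v₁ θ φ * (deriv (fun t => v₁ t φ) θ * sin φ ^ 2 + v₂ θ φ * (sin φ * cos φ)) +
        v₂ θ φ * (deriv (fun t => v₁ θ t) φ * sin φ ^ 2 + v₁ θ φ * (sin φ * cos φ))) θ := by
    unfold vyVySphH
    convert! ((((((hs.const_mul (sin φ * sin φ)).const_mul (deriv (fun t => v₁ t φ) θ)).sub
      ((hc.const_mul (sin φ * sin φ)).const_mul (v₁ θ φ))).add
      (((hc.const_mul (sin φ * cos φ)).const_add (-cos φ * sin φ)).const_mul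
        (deriv (fun t => v₂ t φ) θ))).add
      ((hs.const_mul (sin φ * cos φ)).const_mul (v₂ θ φ))).const_mul (v₁ θ φ)).add
      ((((((hs.const_mul (sin φ * sin φ)).const_mul (deriv (fun t => v₁ θ t) φ)).add
      ((hs.const_mul (sin φ * cos φ)).const_mul (v₁ θ φ))).add
      (((hc.const_mul (sin φ * cos φ)).const_add (-cos φ * sin φ)).const_mul
        (deriv (fun t => v₂ θ t) φ))).add
      ((hc.const_mul (sin φ * sin φ)).const_sub (-cos φ * cos φ) |>.const_mul
        (v₂ θ φ))).const_mul (v₂ θ φ)) using 1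
    ring
  have kφ : HasDerivAt (fun t => vyVySphH v₁ v₂ θ t θ φ)
      (v₁ θ φ * (-v₁ θ φ * (sin φ * cos φ) + deriv (fun t => v₂ t φ) θ) +
        v₂ θ φ * deriv (fun t => v₂ θ t) φ) φ := by
    have hw : HasDerivAt (fun t => -cos t * sin φ + sin t * cos φ) 1 φ := by
      convert! ((hasDerivAt_cos φ).neg.mul_const (sin φ)).add
        ((hasDerivAt_sin φ).mul_const (cos φ)) using 1
      linear_combination -sin_sq_add_cos_sq φ
    have hm : HasDerivAt (fun t => -cos t * cos φ - sin t * sin φ) 0 φ := by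
      convert! ((hasDerivAt_cos φ).neg.mul_const (cos φ)).sub
        ((hasDerivAt_sin φ).mul_const (sin φ)) using 1
      ring
    simp only [vyVySphH, sub_self, cos_zero, sin_zero, mul_one, mul_zero, zero_sub, zero_add,
      add_zero]
    convert! (((((hasDerivAt_sin φ).mul_const (sin φ)).const_mul (v₁ θ φ)).neg.add
      (hw.const_mul (deriv (fun t => v₂ t φ) θ))).const_mul (v₁ θ φ)).add
      (((hw.const_mul (deriv (fun t => v₂ θ t) φ)).add
      (hm.const_mul (v₂ θ φ))).const_mul (v₂ θ φ)) using 1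
    ring
  have eθ := (hasDerivAt_comp_mul_sq_add (hd 2) (hd 1) hhθ (gθ θ).hasDerivAt
    (vySphH_self v₁ v₂ θ φ) kθ).deriv
  have eφ := (hasDerivAt_comp_mul_sq_add (hd 2) (hd 1) hhφ (gφ φ).hasDerivAt
    (vySphH_self v₁ v₂ θ φ) kφ).deriv
  simp only [Function.iterate_succ, Function.iterate_zero, Function.comp_apply, id,
    sphH_self] at eθ eφ
  rw [hPH]
  simp only [Vx, pθx, pφx, eθ, eφ]
  ring
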